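/- Let R₀ > 0 and K > 0. Let ω : ℝ³ → ℝ³ be a continuous vector field with support contained in the closed ball B(0,R₀). Define Ψ(x) = (1/(4π)) ∫_{ℝ³} ω(y)/|x−y| dy and u = curl Ψ. For each R > 0 let φ_R : ℝ³ → ℝ be a smooth function with 0 ≤ φ_R ≤ 1, φ_R(x) = 1 for |x| ≤ R/2, φ_R(x) = 0 for |x| ≥ R, sup_x ‖Dφ_R(x)‖ ≤ K/R, and sup_x ‖D²φ_R(x)‖ ≤ K/R². Then there exists a constant C > 0, depending only on R₀ and K, such that for every R ≥ 8R₀: ‖D(u − curl(φ_R Ψ))‖_{L²(B(0,R))} ≤ C ‖ω‖_{L²(ℝ³)} R^{−3/2}, where D denotes the (Fréchet) derivative (the difference u − curl(φ_R Ψ) vanishes on B(0,R/2) and is smooth on B(0,R) ∖ B(0,R/2), since ω vanishes there). -/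

import Mathlib

open MeasureTheory Real

/-- The curl of a vector field on `ℝ³`, computed via the Fréchet derivative. -/
noncomputable def curl3 (F : EuclideanSpace ℝ (Fin 3) → EuclideanSpace ℝ (Fin 3))
    (x : EuclideanSpace ℝ (Fin 3)) : EuclideanSpace ℝ (Fin 3) :=
  (EuclideanSpace.equiv (Fin 3) ℝ).symm
    ![fderiv ℝ F x (EuclideanSpace.single 1 1) 2 -
        fderiv ℝ F x (EuclideanSpace.single 2 1) 1,
      fderiv ℝ F x (EuclideanSpace.single 2 1) 0 -
        fderiv ℝ F x (EuclideanSpace.single 0 1) 2,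
      fderiv ℝ F x (EuclideanSpace.single 0 1) 1 -
        fderiv ℝ F x (EuclideanSpace.single 1 1) 0]

/-- The componentwise Newtonian potential (vector-valued stream function)
`Ψ(x) = (1/(4π)) ∫ ω(y)/|x−y| dy` of a vector field `ω` on `ℝ³`. -/
noncomputable def vectorStream (ω : EuclideanSpace ℝ (Fin 3) → EuclideanSpace ℝ (Fin 3))
    (x : EuclideanSpace ℝ (Fin 3)) : EuclideanSpace ℝ (Fin 3) :=
  (1 / (4 * π)) • ∫ y, (1 / ‖x - y‖) • ω y

local notation "E3" => EuclideanSpace ℝ (Fin 3)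

lemma aux_curl_clm : ∃ T : (E3 →L[ℝ] E3) →L[ℝ] E3, ∀ F x, curl3 F x = T (fderiv ℝ F x) := by
  let T0 : (E3 →L[ℝ] E3) →ₗ[ℝ] E3 :=
    { toFun := fun A => (EuclideanSpace.equiv (Fin 3) ℝ).symm
        ![A (EuclideanSpace.single 1 1) 2 - A (EuclideanSpace.single 2 1) 1,
          A (EuclideanSpace.single 2 1) 0 - A (EuclideanSpace.single 0 1) 2,
          A (EuclideanSpace.single 0 1) 1 - A (EuclideanSpace.single 1 1) 0]
      map_add' := by
        intro A B
        ext i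
        fin_cases i <;> simp <;> ring
      map_smul' := by
        intro c A
        ext i
        fin_cases i <;> simp <;> ring }
  exact ⟨LinearMap.toContinuousLinearMap T0, fun F x => rfl⟩

set_option maxSynthPendingDepth 5 in
set_option synthInstance.maxHeartbeats 200000 in
lemma aux_hasFDeriv {F H : Type} [NormedAddCommGroup F] [NormedSpace ℝ F]
    [NormedAddCommGroup H] [NormedSpace ℝ H] (L : F →L[ℝ] E3 →L[ℝ] H)
    (k : E3 → F) (R₀ : ℝ) (hd : ∀ z, z ≠ 0 → DifferentiableAt ℝ k z)
    (hc : ContinuousOn (fderiv ℝ k) {0}ᶜ) (ω : E3 → E3) (hω : Continuous ω)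
    (x : E3) (hx : R₀ < ‖x‖) :
    HasFDerivAt (fun x => ∫ y in Metric.closedBall (0 : E3) R₀, L (k (x - y)) (ω y))
      (∫ y in Metric.closedBall (0 : E3) R₀, (L.precompL E3) (fderiv ℝ k (x - y)) (ω y)) x := by
  set S := Metric.closedBall (0 : E3) R₀ with hS
  have hSc : IsCompact S := isCompact_closedBall _ _
  have hne : ∀ x' : E3, R₀ < ‖x'‖ → ∀ y ∈ S, x' - y ≠ 0 := by
    intro x' hx' y hy h
    rw [sub_eq_zero] at h
    subst h
    simp [hS] at hy
    linarith
  have hkc : ContinuousOn k {0}ᶜ := fun z hz => (hd z hz).continuousAt.continuousWithinAt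
  have hsub : ∀ x' : E3, R₀ < ‖x'‖ → Set.MapsTo (fun y => x' - y) S {0}ᶜ := fun x' hx' y hy =>
    hne x' hx' y hy
  have hcont : ∀ x' : E3, R₀ < ‖x'‖ → ContinuousOn (fun y => L (k (x' - y)) (ω y)) S := by
    intro x' hx'
    have h1 : ContinuousOn (fun y => k (x' - y)) S :=
      hkc.comp (by fun_prop) (hsub x' hx')
    exact (L.continuous.comp_continuousOn h1).clm_apply hω.continuousOn
  have hcont' : ContinuousOn (fun y => (L.precompL E3) (fderiv ℝ k (x - y)) (ω y)) S := by
    have h1 : ContinuousOn (fun y => fderiv ℝ k (x - y)) S :=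
      hc.comp (by fun_prop) (hsub x hx)
    exact ((L.precompL E3).continuous.comp_continuousOn h1).clm_apply hω.continuousOn
  set ε := (‖x‖ - R₀) / 2 with hε
  have hεpos : 0 < ε := by rw [hε]; linarith
  have hball : ∀ x' ∈ Metric.closedBall x ε, R₀ < ‖x'‖ := by
    intro x' hx'
    rw [mem_closedBall_iff_norm'] at hx'
    have := norm_sub_norm_le x x'
    rw [hε] at hx'
    linarith
  have hQ : IsCompact ((fun p : E3 × E3 => p.1 - p.2) '' (Metric.closedBall x ε ×ˢ S)) :=
    ((isCompact_closedBall _ _).prod hSc).image (by fun_prop)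
  obtain ⟨M, hM⟩ := hQ.exists_bound_of_continuousOn (f := fderiv ℝ k) (hc.mono (by
    rintro _ ⟨⟨a, b⟩, ⟨ha, hb⟩, rfl⟩
    exact hne a (hball a ha) b hb))
  refine hasFDerivAt_integral_of_dominated_of_fderiv_le (s := Metric.closedBall x ε)
    (F' := fun x y => (L.precompL E3) (fderiv ℝ k (x - y)) (ω y))
    (bound := fun y => ‖L.precompL E3‖ * M * ‖ω y‖) 
    (Metric.closedBall_mem_nhds x hεpos) ?_ ?_ ?_ ?_ ?_ ?_
  · filter_upwards [Metric.closedBall_mem_nhds x hεpos] with x' hx'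
    exact (hcont x' (hball x' hx')).aestronglyMeasurable_of_isCompact hSc hSc.measurableSet
  · exact (hcont x hx).integrableOn_compact hSc
  · exact hcont'.aestronglyMeasurable_of_isCompact hSc hSc.measurableSet
  · filter_upwards [ae_restrict_mem hSc.measurableSet] with y hy x' hx'
    refine ((L.precompL E3).le_opNorm₂ _ _).trans ?_
    gcongr
    exact hM _ ⟨(x', y), ⟨hx', hy⟩, rfl⟩
  · exact (ContinuousOn.integrableOn_compact hSc (by fun_prop))
  · filter_upwards [ae_restrict_mem hSc.measurableSet] with y hy x' hx'
    have h1 : HasFDerivAt (fun x => k (x - y)) (fderiv ℝ k (x' - y)) x' := by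
      have := (hd _ (hne x' (hball x' hx') y hy)).hasFDerivAt
      have h := this.comp x' ((hasFDerivAt_id x').sub_const y)
      rw [ContinuousLinearMap.comp_id] at h
      exact h
    have h2 := (L.flip (ω y)).hasFDerivAt.comp x' h1
    exact h2

lemma aux_bound {F H : Type} [NormedAddCommGroup F] [NormedSpace ℝ F]
    [NormedAddCommGroup H] [NormedSpace ℝ H] (L : F →L[ℝ] E3 →L[ℝ] H)
    (k : E3 → F) (R₀ A : ℝ) (n : ℕ) (hA : 0 ≤ A) (hR₀ : 0 < R₀)
    (hk : ∀ z, z ≠ 0 → ‖k z‖ ≤ A / ‖z‖ ^ n) (ω : E3 → E3) (hω : Continuous ω)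
    (x : E3) (R : ℝ) (hR : 8 * R₀ ≤ R) (hx : R / 2 ≤ ‖x‖) :
    ‖∫ y in Metric.closedBall (0 : E3) R₀, L (k (x - y)) (ω y)‖ ≤
      ‖L‖ * (A / (R / 4) ^ n) * ∫ y in Metric.closedBall (0 : E3) R₀, ‖ω y‖ := by
  have hSc : IsCompact (Metric.closedBall (0 : E3) R₀) := isCompact_closedBall _ _
  rw [← integral_const_mul]
  refine norm_integral_le_of_norm_le (ContinuousOn.integrableOn_compact hSc (by fun_prop)) ?_
  filter_upwards [ae_restrict_mem hSc.measurableSet] with y hy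
  refine (L.le_opNorm₂ _ _).trans ?_
  have hy' : ‖y‖ ≤ R₀ := by simpa using hy
  have h1 : R / 4 ≤ ‖x - y‖ := by
    have := norm_sub_norm_le x y
    linarith
  have h2 : x - y ≠ 0 := by
    rw [← norm_pos_iff]; linarith
  have h3 : 0 < R / 4 := by linarith
  have : ‖k (x - y)‖ ≤ A / (R / 4) ^ n := (hk _ h2).trans (by gcongr)
  gcongr

lemma aux_homog {F : Type} [NormedAddCommGroup F] [NormedSpace ℝ F] (k : E3 → F) (n : ℕ)
    (hk : ∀ c : ℝ, 0 < c → ∀ z, k (c • z) = (c ^ n)⁻¹ • k z) (hc : ContinuousOn k {0}ᶜ) :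
    ∃ A, 0 ≤ A ∧ ∀ z, z ≠ 0 → ‖k z‖ ≤ A / ‖z‖ ^ n := by
  obtain ⟨M, hM⟩ := (isCompact_sphere (0 : E3) 1).exists_bound_of_continuousOn (hc.mono (by
    intro z hz h
    simp at h
    subst h
    simp at hz))
  refine ⟨max M 0, le_max_right _ _, fun z hz => ?_⟩
  have hz' : 0 < ‖z‖ := norm_pos_iff.2 hz
  have h1 : z = ‖z‖ • (‖z‖⁻¹ • z) := by
    rw [smul_smul, mul_inv_cancel₀ hz'.ne', one_smul]
  have h2 : ‖k (‖z‖⁻¹ • z)‖ ≤ M := hM _ (by simp [norm_smul, hz'.ne'])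
  rw [h1, hk _ hz', ← h1, norm_smul, norm_inv, norm_pow, norm_norm, div_eq_inv_mul]
  gcongr
  exact h2.trans (le_max_left _ _)

lemma aux_homog_deriv {F : Type} [NormedAddCommGroup F] [NormedSpace ℝ F] (k : E3 → F) (n : ℕ)
    (hk : ∀ c : ℝ, 0 < c → ∀ z, k (c • z) = (c ^ n)⁻¹ • k z) :
    ∀ c : ℝ, 0 < c → ∀ z, fderiv ℝ k (c • z) = (c ^ (n + 1))⁻¹ • fderiv ℝ k z := by
  intro c hc z
  have h := fderiv_comp_smul (𝕜 := ℝ) (f := k) (x := z) c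
  have h2 : (fun z => k (c • z)) = (c ^ n)⁻¹ • k := funext (hk c hc)
  rw [h2, fderiv_const_smul_field] at h
  have h3 : fderiv ℝ k (c • z) = c⁻¹ • (c • fderiv ℝ k (c • z)) := by
    rw [smul_smul, inv_mul_cancel₀ hc.ne', one_smul]
  rw [h3, ← h, Pi.smul_apply, smul_smul]
  congr 1
  rw [pow_succ, mul_inv, mul_comm]

/-- the kernel -/
noncomputable def auxN (z : E3) : ℝ := 1 / ‖z‖

lemma auxN_homog : ∀ c : ℝ, 0 < c → ∀ z, auxN (c • z) = (c ^ 1)⁻¹ • auxN z := by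
  intro c hc z
  simp [auxN, norm_smul, abs_of_pos hc, mul_comm]

lemma auxN_contDiffOn : ContDiffOn ℝ 3 auxN {0}ᶜ := by
  intro z hz
  refine ContDiffAt.contDiffWithinAt ?_
  unfold auxN
  exact contDiffAt_const.div (contDiffAt_norm ℝ hz) (norm_ne_zero_iff.2 hz)

lemma aux_cs (R₀ : ℝ) : ∃ V : ℝ, 0 ≤ V ∧ ∀ ω : E3 → E3, Continuous ω →
    Function.support ω ⊆ Metric.closedBall 0 R₀ →
    ∫ y in Metric.closedBall (0 : E3) R₀, ‖ω y‖ ≤ V * Real.sqrt (∫ y, ‖ω y‖ ^ 2) := by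
  have hSc : IsCompact (Metric.closedBall (0 : E3) R₀) := isCompact_closedBall _ _
  refine ⟨Real.sqrt (volume.real (Metric.closedBall (0 : E3) R₀)), Real.sqrt_nonneg _, ?_⟩
  intro ω hω hs
  have hfin : IsFiniteMeasure (volume.restrict (Metric.closedBall (0 : E3) R₀)) :=
    ⟨by simpa using hSc.measure_lt_top (μ := volume)⟩
  have h2 : ∫ y in Metric.closedBall (0 : E3) R₀, ‖ω y‖ ^ 2 = ∫ y, ‖ω y‖ ^ 2 := by
    refine setIntegral_eq_integral_of_forall_compl_eq_zero fun y hy => ?_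
    have : ω y = 0 := by
      by_contra h
      exact hy (hs h)
    simp [this]
  have hm : MemLp (fun y => ‖ω y‖) (ENNReal.ofReal 2)
      (volume.restrict (Metric.closedBall (0 : E3) R₀)) := by
    obtain ⟨M, hM⟩ := hSc.exists_bound_of_continuousOn hω.continuousOn
    refine MemLp.of_bound hω.norm.aestronglyMeasurable M ?_
    filter_upwards [ae_restrict_mem hSc.measurableSet] with y hy
    simpa using hM y hy
  have := integral_mul_le_Lp_mul_Lq_of_nonneg (μ := volume.restrict (Metric.closedBall (0 : E3) R₀))
    Real.HolderConjugate.two_two (f := fun _ => (1:ℝ)) (g := fun y => ‖ω y‖)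
    (ae_of_all _ fun _ => by simp) (ae_of_all _ fun _ => by simp) (memLp_const _) hm
  rw [← h2, Real.sqrt_eq_rpow, Real.sqrt_eq_rpow]
  simpa using this

lemma aux_mono (B B' W R : ℝ) (n : ℕ) (hW : 0 ≤ W) (hR : 0 < R) (h : B ≤ B') :
    B * W / R ^ n ≤ B' * W / R ^ n := by gcongr

lemma aux_nn (c l A V : ℝ) (n : ℕ) (hc : 0 ≤ c) (hl : 0 ≤ l) (hA : 0 ≤ A) (hV : 0 ≤ V) :
    0 ≤ c * (l * (A * 4 ^ n) * V) := by positivity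

lemma aux_bound' {F H : Type} [NormedAddCommGroup F] [NormedSpace ℝ F]
    [NormedAddCommGroup H] [NormedSpace ℝ H] (L : F →L[ℝ] E3 →L[ℝ] H)
    (k : E3 → F) (R₀ A : ℝ) (n : ℕ) (hA : 0 ≤ A) (hR₀ : 0 < R₀)
    (hk : ∀ z, z ≠ 0 → ‖k z‖ ≤ A / ‖z‖ ^ n) (ω : E3 → E3) (hω : Continuous ω)
    (x : E3) (R : ℝ) (hR : 8 * R₀ ≤ R) (hx : R / 2 ≤ ‖x‖) (c V W : ℝ) (hc : 0 ≤ c)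
    (hI : ∫ y in Metric.closedBall (0 : E3) R₀, ‖ω y‖ ≤ V * W) :
    ‖c • ∫ y in Metric.closedBall (0 : E3) R₀, L (k (x - y)) (ω y)‖ ≤
      c * (‖L‖ * (A * 4 ^ n) * V) * W / R ^ n := by
  have hRp : 0 < R := by linarith
  rw [norm_smul, Real.norm_of_nonneg hc]
  calc _ ≤ c * (‖L‖ * (A / (R / 4) ^ n) * (V * W)) := by
        gcongr
        refine (aux_bound L k R₀ A n hA hR₀ hk ω hω x R hR hx).trans ?_
        gcongr
    _ = _ := by rw [div_pow]; field_simp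

set_option maxSynthPendingDepth 5 in
set_option synthInstance.maxHeartbeats 200000 in
set_option maxHeartbeats 4000000 in
lemma aux_psi (R₀ : ℝ) (hR₀ : 0 < R₀) : ∃ B : ℝ, 0 < B ∧ ∀ ω : E3 → E3, Continuous ω →
    Function.support ω ⊆ Metric.closedBall 0 R₀ →
    ∃ (Ψ1 : E3 → E3 →L[ℝ] E3) (Ψ2 : E3 → E3 →L[ℝ] E3 →L[ℝ] E3),
      (∀ x, R₀ < ‖x‖ → HasFDerivAt (vectorStream ω) (Ψ1 x) x ∧ HasFDerivAt Ψ1 (Ψ2 x) x) ∧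
      (∀ R x, 8 * R₀ ≤ R → R / 2 ≤ ‖x‖ →
        ‖vectorStream ω x‖ ≤ B * Real.sqrt (∫ y, ‖ω y‖ ^ 2) / R ∧
        ‖Ψ1 x‖ ≤ B * Real.sqrt (∫ y, ‖ω y‖ ^ 2) / R ^ 2 ∧
        ‖Ψ2 x‖ ≤ B * Real.sqrt (∫ y, ‖ω y‖ ^ 2) / R ^ 3) := by
  obtain ⟨V, hV, hVb⟩ := aux_cs R₀
  have ho : IsOpen ({0}ᶜ : Set E3) := isOpen_compl_singleton
  have hk0 : ContDiffOn ℝ 3 auxN {0}ᶜ := auxN_contDiffOn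
  have hk1 : ContDiffOn ℝ 2 (fderiv ℝ auxN) {0}ᶜ := hk0.fderiv_of_isOpen ho (by norm_num)
  have hk2 : ContDiffOn ℝ 1 (fderiv ℝ (fderiv ℝ auxN)) {0}ᶜ := 
    hk1.fderiv_of_isOpen ho (by norm_num)
  have hh1 := aux_homog_deriv auxN 1 auxN_homog
  have hh2 := aux_homog_deriv _ _ hh1
  obtain ⟨A0, hA0, hb0⟩ := aux_homog auxN 1 auxN_homog hk0.continuousOn
  obtain ⟨A1, hA1, hb1⟩ := aux_homog _ _ hh1 hk1.continuousOn
  obtain ⟨A2, hA2, hb2⟩ := aux_homog _ _ hh2 hk2.continuousOn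
  let L0 : ℝ →L[ℝ] E3 →L[ℝ] E3 := ContinuousLinearMap.lsmul ℝ ℝ
  let L1 := L0.precompL E3
  let L2 := L1.precompL E3
  let c : ℝ := 1 / (4 * π)
  have hc : 0 ≤ c := by positivity
  let B0 := c * (‖L0‖ * (A0 * 4 ^ 1) * V)
  let B1 := c * (‖L1‖ * (A1 * 4 ^ 2) * V)
  let B2 := c * (‖L2‖ * (A2 * 4 ^ 3) * V)
  have hB0 : 0 ≤ B0 := aux_nn _ _ _ _ _ hc (norm_nonneg L0) hA0 hV
  have hB1 : 0 ≤ B1 := aux_nn _ _ _ _ _ hc (norm_nonneg L1) hA1 hV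
  have hB2 : 0 ≤ B2 := aux_nn _ _ _ _ _ hc (norm_nonneg L2) hA2 hV
  refine ⟨B0 + B1 + B2 + 1, by linarith, fun ω hω hs => ?_⟩
  have hΨ : vectorStream ω = fun x => c • ∫ y in Metric.closedBall (0 : E3) R₀,
      L0 (auxN (x - y)) (ω y) := by
    funext x
    unfold vectorStream
    congr 1
    symm
    refine setIntegral_eq_integral_of_forall_compl_eq_zero fun y hy => ?_
    have : ω y = 0 := by
      by_contra h
      exact hy (hs h)
    simp [this]
  have hW : 0 ≤ Real.sqrt (∫ y, ‖ω y‖ ^ 2) := Real.sqrt_nonneg _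
  have hI := hVb ω hω hs
  set W := Real.sqrt (∫ y, ‖ω y‖ ^ 2) with hWd
  refine ⟨fun x => c • ∫ y in Metric.closedBall (0 : E3) R₀, L1 (fderiv ℝ auxN (x - y)) (ω y),
    fun x => c • ∫ y in Metric.closedBall (0 : E3) R₀,
      L2 (fderiv ℝ (fderiv ℝ auxN) (x - y)) (ω y), ?_, ?_⟩
  · intro x hx
    constructor
    · rw [hΨ]
      refine HasFDerivAt.const_smul (aux_hasFDeriv L0 auxN R₀ ?_ hk1.continuousOn ω hω x hx) c
      intro z hz
      exact (hk0.differentiableOn (by norm_num) z hz).differentiableAt (ho.mem_nhds hz)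
    · refine HasFDerivAt.const_smul 
        (aux_hasFDeriv L1 (fderiv ℝ auxN) R₀ ?_ hk2.continuousOn ω hω x hx) c
      intro z hz
      exact (hk1.differentiableOn (by norm_num) z hz).differentiableAt (ho.mem_nhds hz)
  · intro R x hR hx
    have hRp : 0 < R := by linarith
    have mono : ∀ (B : ℝ) (n : ℕ), B ≤ B0 + B1 + B2 + 1 →
        B * W / R ^ n ≤ (B0 + B1 + B2 + 1) * W / R ^ n := by
      intro B n hBB
      exact aux_mono _ _ _ _ n hW hRp hBB
    refine ⟨?_, ?_, ?_⟩
    · have h := (aux_bound' L0 auxN R₀ A0 1 hA0 hR₀ hb0 ω hω x R hR hx c V W hc hI).trans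
        (mono B0 1 (by linarith))
      rw [hΨ]
      simpa only [pow_one] using h
    · exact (aux_bound' L1 _ R₀ A1 2 hA1 hR₀ hb1 ω hω x R hR hx c V W hc hI).trans
        (mono B1 2 (by linarith))
    · exact (aux_bound' L2 _ R₀ A2 3 hA2 hR₀ hb2 ω hω x R hR hx c V W hc hI).trans
        (mono B2 3 (by linarith))

set_option maxSynthPendingDepth 5 in
set_option synthInstance.maxHeartbeats 200000 in
lemma aux_point (φ : E3 → ℝ) (Ψ : E3 → E3) (Ψ1 : E3 → E3 →L[ℝ] E3)
    (Ψ2 : E3 → E3 →L[ℝ] E3 →L[ℝ] E3) (R₀ : ℝ)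
    (hd : ∀ x, R₀ < ‖x‖ → HasFDerivAt Ψ (Ψ1 x) x ∧ HasFDerivAt Ψ1 (Ψ2 x) x)
    (hφ : ContDiff ℝ (⊤ : ℕ∞) φ) (hφ1 : ∀ x, φ x ∈ Set.Icc (0:ℝ) 1)
    (a b p q r : ℝ) (x : E3) (hx : R₀ < ‖x‖)
    (ha : ‖fderiv ℝ φ x‖ ≤ a) (hb : ‖fderiv ℝ (fderiv ℝ φ) x‖ ≤ b)
    (hp : ‖Ψ x‖ ≤ p) (hq : ‖Ψ1 x‖ ≤ q) (hr : ‖Ψ2 x‖ ≤ r) :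
    ∃ D : E3 →L[ℝ] E3 →L[ℝ] E3,
      HasFDerivAt (fun z => fderiv ℝ Ψ z - fderiv ℝ (fun w => φ w • Ψ w) z) D x ∧
      ‖D‖ ≤ r + 2 * a * q + b * p := by
  have hφd : ∀ z, HasFDerivAt φ (fderiv ℝ φ z) z := fun z =>
    (hφ.differentiable (by simp) z).hasFDerivAt
  have hφd2 : HasFDerivAt (fderiv ℝ φ) (fderiv ℝ (fderiv ℝ φ) x) x := by
    have : ContDiff ℝ 1 (fderiv ℝ φ) := hφ.fderiv_right (m := 1) (by norm_cast)
    exact (this.differentiable (by simp) x).hasFDerivAt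
  let B := ContinuousLinearMap.smulRightL ℝ E3 E3
  have hev : (fun z => fderiv ℝ Ψ z - fderiv ℝ (fun w => φ w • Ψ w) z) =ᶠ[nhds x]
      fun z => (1 - φ z) • Ψ1 z - B (fderiv ℝ φ z) (Ψ z) := by
    have ho : IsOpen {z : E3 | R₀ < ‖z‖} := isOpen_lt continuous_const continuous_norm
    filter_upwards [ho.mem_nhds hx] with z hz
    have h1 := (hd z hz).1
    rw [h1.fderiv, ((hφd z).fun_smul h1).fderiv]
    ext v i
    simp [B]
    ring
  have h1 := ((hφd x).const_sub 1).smul (hd x hx).2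
  have h2 := B.hasFDerivAt_of_bilinear hφd2 (hd x hx).1
  refine ⟨_, (h1.sub h2).congr_of_eventuallyEq hev, ?_⟩
  have ha0 : 0 ≤ a := (norm_nonneg _).trans ha
  have hb0 : 0 ≤ b := le_trans (norm_nonneg (fderiv ℝ (fderiv ℝ φ) x)) hb
  have hp0 : 0 ≤ p := (norm_nonneg _).trans hp
  have hq0 : 0 ≤ q := (norm_nonneg _).trans hq
  have hr0 : 0 ≤ r := (norm_nonneg _).trans hr
  refine ContinuousLinearMap.opNorm_le_bound _ (by positivity) fun v => ?_
  have e1 : ‖(1 - φ x) • Ψ2 x v‖ ≤ r * ‖v‖ := by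
    rw [norm_smul]
    have : ‖1 - φ x‖ ≤ 1 := by
      obtain ⟨h, h'⟩ := hφ1 x
      rw [Real.norm_eq_abs, abs_le]; constructor <;> linarith
    calc _ ≤ 1 * (r * ‖v‖) := by
          gcongr
          exact (Ψ2 x).le_of_opNorm_le hr v
      _ = _ := one_mul _
  have e2 : ‖fderiv ℝ φ x v • Ψ1 x‖ ≤ a * q * ‖v‖ := by
    rw [norm_smul]
    calc _ ≤ (a * ‖v‖) * q := by
          gcongr
          exact (fderiv ℝ φ x).le_of_opNorm_le ha v
      _ = _ := by ring
  have e3 : ‖B (fderiv ℝ φ x) (Ψ1 x v)‖ ≤ a * q * ‖v‖ := by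
    have : B (fderiv ℝ φ x) (Ψ1 x v) = (fderiv ℝ φ x).smulRight (Ψ1 x v) := rfl
    rw [this, ContinuousLinearMap.norm_smulRight_apply, mul_assoc]
    gcongr
    exact (Ψ1 x).le_of_opNorm_le hq v
  have e4 : ‖B (fderiv ℝ (fderiv ℝ φ) x v) (Ψ x)‖ ≤ b * p * ‖v‖ := by
    have : B (fderiv ℝ (fderiv ℝ φ) x v) (Ψ x) =
      (fderiv ℝ (fderiv ℝ φ) x v).smulRight (Ψ x) := rfl
    rw [this, ContinuousLinearMap.norm_smulRight_apply]
    calc _ ≤ (b * ‖v‖) * p := by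
          gcongr
          exact (fderiv ℝ (fderiv ℝ φ) x).le_of_opNorm_le hb v
      _ = _ := by ring
  calc _ = ‖((1 - φ x) • Ψ2 x v - fderiv ℝ φ x v • Ψ1 x) -
        (B (fderiv ℝ φ x) (Ψ1 x v) + B (fderiv ℝ (fderiv ℝ φ) x v) (Ψ x))‖ := by
        congr 1
        simp
        abel
    _ ≤ (r * ‖v‖ + a * q * ‖v‖) + (a * q * ‖v‖ + b * p * ‖v‖) := by
        refine (norm_sub_le _ _).trans (add_le_add ((norm_sub_le _ _).trans (add_le_add e1 e2)) ((norm_add_le _ _).trans (add_le_add e3 e4)))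
    _ = _ := by ring

theorem truncation3D_L2_gradient (R₀ K : ℝ) (hR₀ : 0 < R₀) (hK : 0 < K) :
    ∃ C > 0, ∀ ω : EuclideanSpace ℝ (Fin 3) → EuclideanSpace ℝ (Fin 3),
      Continuous ω →
      Function.support ω ⊆ Metric.closedBall 0 R₀ →
      ∀ φ : ℝ → EuclideanSpace ℝ (Fin 3) → ℝ,
      (∀ R : ℝ, 0 < R →
        ContDiff ℝ (⊤ : ℕ∞) (φ R) ∧
        (∀ x, φ R x ∈ Set.Icc (0:ℝ) 1) ∧
        (∀ x : EuclideanSpace ℝ (Fin 3), ‖x‖ ≤ R / 2 → φ R x = 1) ∧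
        (∀ x : EuclideanSpace ℝ (Fin 3), R ≤ ‖x‖ → φ R x = 0) ∧
        (∀ x, ‖fderiv ℝ (φ R) x‖ ≤ K / R) ∧
        (∀ x, ‖fderiv ℝ (fderiv ℝ (φ R)) x‖ ≤ K / R ^ 2)) →
      ∀ R : ℝ, 8 * R₀ ≤ R →
        eLpNorm
            (fun x => fderiv ℝ
              (fun z => curl3 (vectorStream ω) z -
                curl3 (fun w => φ R w • vectorStream ω w) z) x) 2
            (volume.restrict (Metric.ball 0 R)) ≤
          ENNReal.ofReal
            (C * Real.sqrt (∫ y, ‖ω y‖ ^ 2) * R ^ (-(3/2 : ℝ))) := by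
  obtain ⟨T, hT⟩ := aux_curl_clm
  obtain ⟨B, hB, hΨ⟩ := aux_psi R₀ hR₀
  set v : ℝ := √π ^ 3 / Gamma (3 / 2 + 1) with hv
  have hvpos : 0 < v := by
    have : 0 < Gamma (3 / 2 + 1 : ℝ) := Real.Gamma_pos_of_pos (by norm_num)
    positivity
  set C0 : ℝ := (‖T‖ + 1) * ((1 + 3 * K) * B) with hC0
  have hC0pos : 0 < C0 := by positivity
  refine ⟨v ^ (1 / 2 : ℝ) * C0, by positivity, fun ω hω hs φ hφ R hR => ?_⟩
  have hRp : 0 < R := by linarith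
  obtain ⟨Ψ1, Ψ2, hd, hb⟩ := hΨ ω hω hs
  obtain ⟨hφs, hφ1, hφe, -, hφa, hφb⟩ := hφ R hRp
  set W := Real.sqrt (∫ y, ‖ω y‖ ^ 2) with hWd
  have hW : 0 ≤ W := Real.sqrt_nonneg _
  have hpt : ∀ x, ‖fderiv ℝ (fun z => curl3 (vectorStream ω) z -
                curl3 (fun w => φ R w • vectorStream ω w) z) x‖ ≤ C0 * W / R ^ 3 := by
    intro x
    rcases lt_or_ge ‖x‖ (R / 2) with hx | hx
    · have ho : IsOpen {z : E3 | ‖z‖ < R / 2} := isOpen_lt continuous_norm continuous_const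
      have hev : (fun z => curl3 (vectorStream ω) z -
                curl3 (fun w => φ R w • vectorStream ω w) z) =ᶠ[nhds x] fun _ => 0 := by
        filter_upwards [ho.mem_nhds hx] with z hz
        rw [hT, hT, sub_eq_zero]
        congr 1
        refine Filter.EventuallyEq.fderiv_eq ?_
        filter_upwards [ho.mem_nhds hz] with w hw
        rw [hφe w (le_of_lt hw), one_smul]
      rw [hev.fderiv_eq]
      simp
      positivity
    · obtain ⟨h0, h1, h2⟩ := hb R x hR hx
      obtain ⟨D, hD, hDb⟩ := aux_point (φ R) (vectorStream ω) Ψ1 Ψ2 R₀ hd hφs hφ1 _ _ _ _ _ x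
        (by linarith) (hφa x) (hφb x) h0 h1 h2
      have hE : HasFDerivAt (fun z => curl3 (vectorStream ω) z -
                curl3 (fun w => φ R w • vectorStream ω w) z) (T.comp D) x := by
        simp only [hT, ← map_sub]
        exact T.hasFDerivAt.comp x hD
      rw [hE.fderiv]
      refine (T.opNorm_comp_le D).trans ?_
      calc ‖T‖ * ‖D‖ ≤ (‖T‖ + 1) * (B * W / R ^ 3 + 2 * (K / R) * (B * W / R ^ 2) +
            K / R ^ 2 * (B * W / R)) := by
            gcongr
            linarith
        _ = _ := by
            rw [hC0]
            field_simp
            ring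
  refine (eLpNorm_le_of_ae_bound (C := C0 * W / R ^ 3) (ae_of_all _ hpt)).trans ?_
  have hvol : (volume.restrict (Metric.ball (0 : E3) R)) Set.univ = ENNReal.ofReal (R ^ 3 * v) := by
    rw [Measure.restrict_apply_univ, EuclideanSpace.volume_ball, ENNReal.ofReal_mul (by positivity),
      ENNReal.ofReal_pow hRp.le, hv]
    simp
  rw [hvol, ENNReal.ofReal_rpow_of_nonneg (by positivity) (by simp),
    ← ENNReal.ofReal_mul (by positivity)]
  refine ENNReal.ofReal_le_ofReal (le_of_eq ?_)
  have h32 : (R ^ 3) ^ (1 / 2 : ℝ) = R ^ (-(3 / 2 : ℝ)) * R ^ 3 := by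
    rw [← Real.rpow_natCast, ← Real.rpow_mul hRp.le, ← Real.rpow_add hRp]
    norm_num
  have : (ENNReal.toReal 2)⁻¹ = (1 / 2 : ℝ) := by simp
  rw [this, Real.mul_rpow (by positivity) hvpos.le, h32]
  field_simp
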